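/- arXiv:1202.1598 — 2 statements merged into one kernel-verified Lean document; each statement's English description precedes it below -/
import Mathlib

section
/- Let ρ be a bipartite quantum state on ℂ² ⊗ ℂ^N whose reduced state on the first factor is maximally mixed, i.e., Tr_B(ρ) = I₂/2 (equivalently, the Bloch vector r with r_i = tr(ρ(σ_i⊗I_N)) vanishes). Then, with T ∈ ℝ^{3×(N²−1)} defined by T_{ij} = (N/2)·tr(ρ (σ_i ⊗ σ^B_j)) for Pauli matrices σ_i and any family {σ^B_j}_{j=1}^{N²−1} of traceless Hermitian N×N matrices satisfying tr(σ^B_i σ^B_j) = 2δ_{ij}, one has equality: D(ρ) = (√2/N)·√( Σ_{i,j} T_{ij}² − λ_max(T Tᵀ) ). -/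
open Matrix Kronecker BigOperators ComplexOrder

noncomputable section

/-- Frobenius (Hilbert–Schmidt) norm of a square complex matrix. -/
def frob {n : Type*} [Fintype n] (A : Matrix n n ℂ) : ℝ :=
  Real.sqrt (Matrix.trace (Aᴴ * A)).re

/-- Conjugation of a bipartite matrix by `U ⊗ I`. -/
def conjA {M N : ℕ} (U : Matrix (Fin M) (Fin M) ℂ)
    (ρ : Matrix (Fin M × Fin N) (Fin M × Fin N) ℂ) :
    Matrix (Fin M × Fin N) (Fin M × Fin N) ℂ :=
  (U ⊗ₖ (1 : Matrix (Fin N) (Fin N) ℂ)) * ρ * (U ⊗ₖ (1 : Matrix (Fin N) (Fin N) ℂ))ᴴ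

/-- The quantity `D(ρ,U) = (1/√2)·‖ρ − (U⊗I) ρ (U⊗I)†‖_F`. -/
def DU {M N : ℕ} (ρ : Matrix (Fin M × Fin N) (Fin M × Fin N) ℂ)
    (U : Matrix (Fin M) (Fin M) ℂ) : ℝ :=
  (1 / Real.sqrt 2) * frob (ρ - conjA U ρ)

/-- A Root-of-Unity (RU) unitary: a unitary whose eigenvalues, with multiplicity,
are exactly the `M` distinct `M`-th roots of unity. -/
def IsRU {M : ℕ} (U : Matrix (Fin M) (Fin M) ℂ) : Prop :=
  ∃ V ∈ Matrix.unitaryGroup (Fin M) ℂ,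
    U = V * Matrix.diagonal (fun k : Fin M =>
      Complex.exp (2 * Real.pi * Complex.I * (((k : ℕ) : ℂ) + 1) / (M : ℂ))) * Vᴴ

/-- The measure `D(ρ)`: infimum of `D(ρ,U)` over RU unitaries `U`. -/
def Dm {M N : ℕ} (ρ : Matrix (Fin M × Fin N) (Fin M × Fin N) ℂ) : ℝ :=
  sInf {d : ℝ | ∃ U, IsRU U ∧ d = DU ρ U}

/-- A bipartite quantum state: positive semidefinite with unit trace. -/
def IsState {M N : ℕ} (ρ : Matrix (Fin M × Fin N) (Fin M × Fin N) ℂ) : Prop :=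
  ρ.PosSemidef ∧ ρ.trace = 1

/-- Partial trace over the second tensor factor. -/
def traceB {M N : ℕ} (ρ : Matrix (Fin M × Fin N) (Fin M × Fin N) ℂ) :
    Matrix (Fin M) (Fin M) ℂ :=
  Matrix.of fun p q => ∑ j : Fin N, ρ (p, j) (q, j)

/-- Rank-one outer product `|v⟩⟨v|`. -/
def outer {α : Type*} (v : α → ℂ) : Matrix α α ℂ :=
  Matrix.of fun i j => v i * (starRingEnd ℂ) (v j)

/-- The Pauli matrices. -/
def pauli : Fin 3 → Matrix (Fin 2) (Fin 2) ℂ :=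
  ![!![0, 1; 1, 0], !![0, -Complex.I; Complex.I, 0], !![1, 0; 0, -1]]


/-- Correlation matrix `T_{ij} = (N/2)·tr(ρ (σ_i ⊗ σ^B_j))`. -/
def corrT {N : ℕ} (ρ : Matrix (Fin 2 × Fin N) (Fin 2 × Fin N) ℂ)
    (σB : Fin (N ^ 2 - 1) → Matrix (Fin N) (Fin N) ℂ) :
    Matrix (Fin 3) (Fin (N ^ 2 - 1)) ℝ :=
  Matrix.of fun i j => (N / 2 : ℝ) * (Matrix.trace (ρ * (pauli i ⊗ₖ σB j))).re

lemma real_isHermitian_mul_transpose_self {n m : ℕ} (T : Matrix (Fin n) (Fin m) ℝ) :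
    (T * Tᵀ).IsHermitian := by
  ext i j
  simp only [Matrix.conjTranspose_apply, Matrix.mul_apply, Matrix.transpose_apply, star_trivial]
  exact Finset.sum_congr rfl fun k _ => mul_comm _ _

/-- The matrix `tr_A((σ_i ⊗ I) ρ)` on the second factor. -/
def pauliBlock {N : ℕ} (ρ : Matrix (Fin 2 × Fin N) (Fin 2 × Fin N) ℂ) (i : Fin 3) :
    Matrix (Fin N) (Fin N) ℂ :=
  Matrix.of fun a b => ∑ p, ∑ q, pauli i q p * ρ (p, a) (q, b)

/-- The observable `n · σ`. -/
def pauliVec (n : Fin 3 → ℝ) : Matrix (Fin 2) (Fin 2) ℂ :=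
  ∑ i, (n i : ℂ) • pauli i

lemma pauliVec_eq (n : Fin 3 → ℝ) :
    pauliVec n = !![(n 2 : ℂ), n 0 - n 1 * Complex.I; n 0 + n 1 * Complex.I, -n 2] := by
  ext p q
  fin_cases p <;> fin_cases q <;>
    simp [pauliVec, Fin.sum_univ_three, pauli]
  ring

lemma pauli_isHermitian (i : Fin 3) : (pauli i).IsHermitian := by
  ext p q
  fin_cases i <;> fin_cases p <;> fin_cases q <;> simp [pauli]

lemma trace_pauli_mul_pauli (i j : Fin 3) :
    (pauli i * pauli j).trace = if i = j then 2 else 0 := by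
  fin_cases i <;> fin_cases j <;>
    simp [pauli, Matrix.trace_fin_two] <;> norm_num

lemma pauliVec_isHermitian (n : Fin 3 → ℝ) : (pauliVec n).IsHermitian := by
  simp [pauliVec, Matrix.IsHermitian, Matrix.conjTranspose_sum, Matrix.conjTranspose_smul,
    (pauli_isHermitian _).eq]

lemma trace_pauliVec (n : Fin 3 → ℝ) : (pauliVec n).trace = 0 := by
  simp [pauliVec_eq, Matrix.trace_fin_two]

lemma exists_pauliVec_of_isHermitian {U : Matrix (Fin 2) (Fin 2) ℂ} (hU : U.IsHermitian)
    (htr : U.trace = 0) : ∃ n, U = pauliVec n := by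
  have h00 := hU.apply 0 0
  have h10 := hU.apply 1 0
  rw [Matrix.trace_fin_two] at htr
  refine ⟨![(U 1 0).re, (U 1 0).im, (U 0 0).re], ?_⟩
  have hz : ((U 0 0).re : ℂ) = U 0 0 := Complex.conj_eq_iff_re.mp h00
  rw [pauliVec_eq]
  ext p q
  fin_cases p <;> fin_cases q <;> simp
  · exact hz.symm
  · rw [← hU.apply 0 1]
    apply Complex.ext <;> simp
  · rw [hz]
    linear_combination htr

lemma dotProduct_self_of_pauliVec_mul_self {n : Fin 3 → ℝ}
    (h : pauliVec n * pauliVec n = 1) : n ⬝ᵥ n = 1 := by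
  have h00 := congrFun (congrFun h 0) 0
  simp [pauliVec_eq, Matrix.mul_apply, Fin.sum_univ_two] at h00
  have hI := Complex.I_mul_I
  have : (n 0 : ℂ) * n 0 + n 1 * n 1 + n 2 * n 2 = 1 := by
    linear_combination h00 + (n 1 : ℂ) ^ 2 * hI
  rw [dotProduct, Fin.sum_univ_three]
  exact_mod_cast this

lemma diagonal_roots_of_unity_two :
    Matrix.diagonal (fun k : Fin 2 =>
      Complex.exp (2 * Real.pi * Complex.I * (((k : ℕ) : ℂ) + 1) / ((2 : ℕ) : ℂ)))
      = Matrix.diagonal ![-1, 1] := by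
  congr 1
  ext k
  fin_cases k
  · refine Eq.trans ?_ Complex.exp_pi_mul_I
    congr 1
    simp only [Nat.cast_zero, Nat.cast_ofNat]
    ring
  · refine Eq.trans ?_ Complex.exp_two_pi_mul_I
    congr 1
    simp only [Nat.cast_one, Nat.cast_ofNat]
    ring

lemma exists_pauliVec_of_isRU {U : Matrix (Fin 2) (Fin 2) ℂ} (hU : IsRU U) :
    ∃ n, n ⬝ᵥ n = 1 ∧ U = pauliVec n := by
  obtain ⟨V, hV, rfl⟩ := hU
  rw [diagonal_roots_of_unity_two]
  have hVV : Vᴴ * V = 1 := Matrix.mem_unitaryGroup_iff'.mp hV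
  have hVV' : V * Vᴴ = 1 := Matrix.mem_unitaryGroup_iff.mp hV
  have hd : (Matrix.diagonal ![(-1 : ℂ), 1]) * Matrix.diagonal ![-1, 1] = 1 := by
    rw [Matrix.diagonal_mul_diagonal, ← Matrix.diagonal_one]
    congr 1
    ext k
    fin_cases k <;> simp
  have hherm : (V * Matrix.diagonal ![-1, 1] * Vᴴ).IsHermitian := by
    apply Matrix.isHermitian_mul_mul_conjTranspose
    ext p q
    fin_cases p <;> fin_cases q <;> simp
  have htr : (V * Matrix.diagonal ![-1, 1] * Vᴴ).trace = 0 := by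
    rw [Matrix.trace_mul_comm, ← mul_assoc, hVV, one_mul, Matrix.trace_fin_two]
    simp
  have hsq : (V * Matrix.diagonal ![-1, 1] * Vᴴ) * (V * Matrix.diagonal ![-1, 1] * Vᴴ) = 1 := by
    calc _ = V * Matrix.diagonal ![-1, 1] * (Vᴴ * V) * Matrix.diagonal ![-1, 1] * Vᴴ := by
          simp only [mul_assoc]
      _ = _ := by rw [hVV, mul_one, mul_assoc V, hd, mul_one, hVV']
  obtain ⟨n, hn⟩ := exists_pauliVec_of_isHermitian hherm htr
  rw [hn] at hsq ⊢
  exact ⟨n, dotProduct_self_of_pauliVec_mul_self hsq, rfl⟩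

lemma isRU_pauliVec {n : Fin 3 → ℝ} (hn : n ⬝ᵥ n = 1) : IsRU (pauliVec n) := by
  have hU := pauliVec_isHermitian n
  have hsp := hU.spectral_theorem
  rw [Unitary.conjStarAlgAut_apply] at hsp
  set E := hU.eigenvectorUnitary
  have hdet := hU.det_eq_prod_eigenvalues
  have htr := hU.trace_eq_sum_eigenvalues
  have h : (n 0 : ℂ) * n 0 + n 1 * n 1 + n 2 * n 2 = 1 := by
    rw [dotProduct, Fin.sum_univ_three] at hn
    exact_mod_cast hn
  have hdet' : (pauliVec n).det = -1 := by
    rw [pauliVec_eq, Matrix.det_fin_two_of]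
    linear_combination -h + (n 1 : ℂ) ^ 2 * Complex.I_mul_I
  rw [trace_pauliVec, Fin.sum_univ_two] at htr
  rw [hdet', Fin.prod_univ_two] at hdet
  have hs : hU.eigenvalues 1 = - hU.eigenvalues 0 := by
    have : (0 : ℝ) = hU.eigenvalues 0 + hU.eigenvalues 1 :=
      Complex.ofReal_injective (by simpa using htr)
    linarith
  have hp : hU.eigenvalues 0 * hU.eigenvalues 0 = 1 := by
    have : (-1 : ℝ) = hU.eigenvalues 0 * hU.eigenvalues 1 :=
      Complex.ofReal_injective (by simpa using hdet)
    rw [hs] at this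
    linarith
  unfold IsRU
  rw [diagonal_roots_of_unity_two]
  rcases mul_self_eq_one_iff.mp hp with h0 | h0
  · refine ⟨(E : Matrix (Fin 2) (Fin 2) ℂ) * pauli 0, ?_, ?_⟩
    · apply mul_mem E.2
      rw [Matrix.mem_unitaryGroup_iff, Matrix.star_eq_conjTranspose, (pauli_isHermitian 0).eq]
      simp [pauli, Matrix.one_fin_two]
    · conv_lhs => rw [hsp]
      rw [Matrix.conjTranspose_mul, (pauli_isHermitian 0).eq]
      rw [show ∀ A B C : Matrix (Fin 2) (Fin 2) ℂ, A * B * C * (B * Aᴴ) = A * (B * C * B) * Aᴴ by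
        intros; simp only [mul_assoc]]
      rw [Matrix.star_eq_conjTranspose]
      congr 2
      ext p q
      fin_cases p <;> fin_cases q <;> simp [pauli, h0, hs, Matrix.mul_apply, Fin.sum_univ_two,
        -Matrix.cons_mul]
  · refine ⟨E, E.2, ?_⟩
    conv_lhs => rw [hsp]
    rw [Matrix.star_eq_conjTranspose]
    congr 2
    ext p q
    fin_cases p <;> fin_cases q <;> simp [h0, hs]

lemma pauliBlock_isHermitian {N : ℕ} {ρ : Matrix (Fin 2 × Fin N) (Fin 2 × Fin N) ℂ}
    (hρ : ρ.IsHermitian) (i : Fin 3) : (pauliBlock ρ i).IsHermitian := by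
  ext a b
  simp only [pauliBlock, Matrix.conjTranspose_apply, Matrix.of_apply, star_sum, star_mul',
    hρ.apply, (pauli_isHermitian i).apply]
  exact Finset.sum_comm

lemma trace_mul_pauli_kronecker {N : ℕ} (ρ : Matrix (Fin 2 × Fin N) (Fin 2 × Fin N) ℂ)
    (i : Fin 3) (Y : Matrix (Fin N) (Fin N) ℂ) :
    (ρ * (pauli i ⊗ₖ Y)).trace = (pauliBlock ρ i * Y).trace := by
  simp only [Matrix.trace, Matrix.diag, Matrix.mul_apply, Fintype.sum_prod_type,
    Matrix.kroneckerMap_apply, pauliBlock, Matrix.of_apply, Fin.sum_univ_two,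
    ← Finset.sum_add_distrib]
  refine Finset.sum_congr rfl fun a _ => Finset.sum_congr rfl fun b _ => ?_
  ring

lemma trace_pauliBlock {N : ℕ} {ρ : Matrix (Fin 2 × Fin N) (Fin 2 × Fin N) ℂ}
    (hmix : traceB ρ = (1 / 2 : ℂ) • (1 : Matrix (Fin 2) (Fin 2) ℂ)) (i : Fin 3) :
    (pauliBlock ρ i).trace = 0 := by
  have h : (pauliBlock ρ i).trace = ∑ p, ∑ q, pauli i q p * traceB ρ p q := by
    simp only [Matrix.trace, Matrix.diag, pauliBlock, traceB, Matrix.of_apply, Finset.mul_sum,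
      Fin.sum_univ_two, Finset.sum_add_distrib]
  rw [h, hmix]
  fin_cases i <;> simp [pauli, Fin.sum_univ_two]

lemma sub_conjA_pauliVec {N : ℕ} (ρ : Matrix (Fin 2 × Fin N) (Fin 2 × Fin N) ℂ)
    {n : Fin 3 → ℝ} (hn : n ⬝ᵥ n = 1) :
    ρ - conjA (pauliVec n) ρ
      = ∑ i, pauli i ⊗ₖ (pauliBlock ρ i - (n i : ℂ) • ∑ k, (n k : ℂ) • pauliBlock ρ k) := by
  have h : (n 0 : ℂ) * n 0 + n 1 * n 1 + n 2 * n 2 = 1 := by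
    rw [dotProduct, Fin.sum_univ_three] at hn
    exact_mod_cast hn
  have hI := Complex.I_sq
  rw [conjA, Matrix.conjTranspose_kronecker, (pauliVec_isHermitian n).eq,
    Matrix.conjTranspose_one, pauliVec_eq]
  ext ⟨p, a⟩ ⟨q, b⟩
  simp only [Matrix.sub_apply, Matrix.mul_apply, Fintype.sum_prod_type, Matrix.kroneckerMap_apply,
    Matrix.one_apply, mul_ite, mul_one, mul_zero, ite_mul, zero_mul, Finset.sum_ite_eq,
    Finset.sum_ite_eq', Finset.mem_univ, if_true, Fin.sum_univ_two, Matrix.add_apply,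
    Fin.sum_univ_three, Matrix.smul_apply, smul_eq_mul, pauliBlock, Matrix.of_apply]
  fin_cases p <;> fin_cases q <;> simp [pauli]
  · linear_combination -ρ (1, a) (1, b) * h + (n 1 : ℂ) ^ 2 * ρ (1, a) (1, b) * hI
  · linear_combination ρ (0, a) (1, b) * h
      + (ρ (0, a) (1, b) - (n 1 : ℂ) ^ 2 * ρ (0, a) (1, b) - ρ (1, a) (0, b)) * hI
  · linear_combination ρ (1, a) (0, b) * h
      + (ρ (1, a) (0, b) - (n 1 : ℂ) ^ 2 * ρ (1, a) (0, b) - ρ (0, a) (1, b)) * hI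
  · linear_combination -ρ (0, a) (0, b) * h + (n 1 : ℂ) ^ 2 * ρ (0, a) (0, b) * hI

lemma trace_conjTranspose_mul_self_pauli_expansion {N : ℕ}
    {S : Fin 3 → Matrix (Fin N) (Fin N) ℂ} (hS : ∀ i, (S i).IsHermitian) :
    ((∑ i, pauli i ⊗ₖ S i)ᴴ * ∑ i, pauli i ⊗ₖ S i).trace = 2 * ∑ i, (S i * S i).trace := by
  simp only [Matrix.conjTranspose_sum, Matrix.conjTranspose_kronecker, (pauli_isHermitian _).eq,
    (hS _).eq, Finset.sum_mul, Finset.mul_sum, Matrix.trace_sum, ← Matrix.mul_kronecker_mul,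
    Matrix.trace_kronecker, trace_pauli_mul_pauli, ite_mul, zero_mul]
  simp

/-- Traceless orthogonal matrices that are `N ^ 2 - 1` in number expand every traceless matrix. -/
lemma exists_expansion_of_trace_eq_zero {N : ℕ} (hN : 0 < N)
    {σB : Fin (N ^ 2 - 1) → Matrix (Fin N) (Fin N) ℂ}
    (htrace : ∀ j, (σB j).trace = 0)
    (horth : ∀ i j, (σB i * σB j).trace = if i = j then 2 else 0)
    {X : Matrix (Fin N) (Fin N) ℂ} (hX : X.trace = 0) :
    ∃ c : Fin (N ^ 2 - 1) → ℂ, X = ∑ j, c j • σB j := by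
  have hN' : (N : ℂ) ≠ 0 := by exact_mod_cast hN.ne'
  let b : Option (Fin (N ^ 2 - 1)) → Matrix (Fin N) (Fin N) ℂ := fun o => o.elim 1 σB
  have hb : LinearIndependent ℂ b := by
    rw [Fintype.linearIndependent_iff]
    intro g hg
    simp only [Fintype.sum_option, b, Option.elim_none, Option.elim_some] at hg
    have h0 : g none = 0 := by
      have := congrArg Matrix.trace hg
      simpa [Matrix.trace_sum, htrace, hN'] using this
    rintro (_ | j)
    · exact h0
    · have := congrArg (fun M => (M * σB j).trace) hg
      simpa [h0, Finset.sum_mul, Matrix.trace_sum, horth] using this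
  have hcard : Fintype.card (Option (Fin (N ^ 2 - 1)))
      = Module.finrank ℂ (Matrix (Fin N) (Fin N) ℂ) := by
    rw [Module.finrank_matrix, Fintype.card_option]
    simp only [Fintype.card_fin, Module.finrank_self, mul_one]
    have : 0 < N ^ 2 := by positivity
    rw [← sq]
    omega
  have hspan : X ∈ Submodule.span ℂ (Set.range b) := by
    rw [hb.span_eq_top_of_card_eq_finrank' hcard]
    trivial
  obtain ⟨c, hc⟩ := (Submodule.mem_span_range_iff_exists_fun ℂ).mp hspan
  simp only [Fintype.sum_option, b, Option.elim_none, Option.elim_some] at hc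
  have h0 : c none = 0 := by
    have := congrArg Matrix.trace hc
    simpa [Matrix.trace_sum, htrace, hN', hX] using this
  exact ⟨fun j => c (some j), by rw [← hc, h0, zero_smul, zero_add]⟩

/-- Parseval's identity for traceless matrices. -/
lemma trace_mul_eq_half_sum {N : ℕ} (hN : 0 < N)
    {σB : Fin (N ^ 2 - 1) → Matrix (Fin N) (Fin N) ℂ}
    (htrace : ∀ j, (σB j).trace = 0)
    (horth : ∀ i j, (σB i * σB j).trace = if i = j then 2 else 0)
    {X : Matrix (Fin N) (Fin N) ℂ} (hX : X.trace = 0) (Y : Matrix (Fin N) (Fin N) ℂ) :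
    (X * Y).trace = (1 / 2) * ∑ j, (X * σB j).trace * (Y * σB j).trace := by
  obtain ⟨c, rfl⟩ := exists_expansion_of_trace_eq_zero hN htrace horth hX
  simp only [Finset.sum_mul, Matrix.trace_sum, Matrix.smul_mul, Matrix.trace_smul, smul_eq_mul,
    horth, mul_ite, mul_zero, Finset.sum_ite_eq', Finset.mem_univ, if_true, Finset.mul_sum]
  refine Finset.sum_congr rfl fun j _ => ?_
  rw [Matrix.trace_mul_comm Y]
  ring

lemma ofReal_re_trace_mul {N : ℕ} {X Y : Matrix (Fin N) (Fin N) ℂ} (hX : X.IsHermitian)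
    (hY : Y.IsHermitian) : (((X * Y).trace).re : ℂ) = (X * Y).trace := by
  rw [← Complex.conj_eq_iff_re]
  change star _ = _
  rw [← Matrix.trace_conjTranspose, Matrix.conjTranspose_mul, hX.eq, hY.eq,
    Matrix.trace_mul_comm]

lemma trace_pauliBlock_mul_pauliBlock {N : ℕ} (hN : 0 < N)
    {ρ : Matrix (Fin 2 × Fin N) (Fin 2 × Fin N) ℂ} (hρ : ρ.IsHermitian)
    (hmix : traceB ρ = (1 / 2 : ℂ) • (1 : Matrix (Fin 2) (Fin 2) ℂ))
    {σB : Fin (N ^ 2 - 1) → Matrix (Fin N) (Fin N) ℂ}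
    (hherm : ∀ j, (σB j).IsHermitian)
    (htrace : ∀ j, (σB j).trace = 0)
    (horth : ∀ i j, (σB i * σB j).trace = if i = j then 2 else 0) (i k : Fin 3) :
    (pauliBlock ρ i * pauliBlock ρ k).trace
      = ((2 / N ^ 2 * (corrT ρ σB * (corrT ρ σB)ᵀ) i k : ℝ) : ℂ) := by
  have hN' : (N : ℂ) ≠ 0 := by exact_mod_cast hN.ne'
  have hT : ∀ i j, (pauliBlock ρ i * σB j).trace = 2 / N * (corrT ρ σB i j : ℂ) := by
    intro i j
    rw [corrT, Matrix.of_apply, trace_mul_pauli_kronecker]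
    push_cast
    rw [ofReal_re_trace_mul (pauliBlock_isHermitian hρ i) (hherm j)]
    field_simp
  rw [trace_mul_eq_half_sum hN htrace horth (trace_pauliBlock hmix i), Matrix.mul_apply]
  simp only [hT, Matrix.transpose_apply]
  push_cast
  rw [Finset.mul_sum, Finset.mul_sum]
  refine Finset.sum_congr rfl fun j _ => ?_
  field_simp

lemma DU_pauliVec {N : ℕ} (hN : 0 < N)
    {ρ : Matrix (Fin 2 × Fin N) (Fin 2 × Fin N) ℂ} (hρ : ρ.IsHermitian)
    (hmix : traceB ρ = (1 / 2 : ℂ) • (1 : Matrix (Fin 2) (Fin 2) ℂ))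
    {σB : Fin (N ^ 2 - 1) → Matrix (Fin N) (Fin N) ℂ}
    (hherm : ∀ j, (σB j).IsHermitian)
    (htrace : ∀ j, (σB j).trace = 0)
    (horth : ∀ i j, (σB i * σB j).trace = if i = j then 2 else 0)
    {n : Fin 3 → ℝ} (hn : n ⬝ᵥ n = 1) :
    DU ρ (pauliVec n) = (Real.sqrt 2 / N) * Real.sqrt
      ((∑ i, ∑ j, corrT ρ σB i j ^ 2) - n ⬝ᵥ (corrT ρ σB * (corrT ρ σB)ᵀ) *ᵥ n) := by
  set G := corrT ρ σB * (corrT ρ σB)ᵀ with hG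
  have hherm' : (∑ k, (n k : ℂ) • pauliBlock ρ k).IsHermitian := by
    simp [Matrix.IsHermitian, Matrix.conjTranspose_sum, Matrix.conjTranspose_smul,
      (pauliBlock_isHermitian hρ _).eq]
  have hS : ∀ i, (pauliBlock ρ i - (n i : ℂ) • ∑ k, (n k : ℂ) • pauliBlock ρ k).IsHermitian := by
    intro i
    refine (pauliBlock_isHermitian hρ i).sub ?_
    rw [Matrix.IsHermitian, Matrix.conjTranspose_smul, hherm'.eq]
    simp
  have htr : ∑ i, ∑ j, corrT ρ σB i j ^ 2 = ∑ i, G i i := by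
    simp [hG, Matrix.mul_apply, sq]
  have hn' : n 0 * n 0 + n 1 * n 1 + n 2 * n 2 = 1 := by
    rwa [dotProduct, Fin.sum_univ_three] at hn
  have hsum : (∑ i, ((pauliBlock ρ i - (n i : ℂ) • ∑ k, (n k : ℂ) • pauliBlock ρ k)
      * (pauliBlock ρ i - (n i : ℂ) • ∑ k, (n k : ℂ) • pauliBlock ρ k)).trace)
      = ((2 / N ^ 2 * (∑ i, G i i - n ⬝ᵥ G *ᵥ n) : ℝ) : ℂ) := by
    have hGg : ∀ i k, (pauliBlock ρ i * pauliBlock ρ k).trace = ((2 / N ^ 2 * G i k : ℝ) : ℂ) :=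
      trace_pauliBlock_mul_pauliBlock hN hρ hmix hherm htrace horth
    have hnc : (n 0 : ℂ) * n 0 + n 1 * n 1 + n 2 * n 2 = 1 := by exact_mod_cast hn'
    set B := ∑ k, (n k : ℂ) • pauliBlock ρ k with hB
    have h1 : ∑ i, (n i : ℂ) * (pauliBlock ρ i * B).trace = (B * B).trace := by
      have : ∀ C, ((∑ k, (n k : ℂ) • pauliBlock ρ k) * C).trace
          = ∑ k, (n k : ℂ) * (pauliBlock ρ k * C).trace := fun C => by
        simp only [Finset.sum_mul, Matrix.trace_sum, Matrix.smul_mul, Matrix.trace_smul,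
          smul_eq_mul]
      exact (this B).symm
    have h2 : (B * B).trace = ((2 / N ^ 2 * (n ⬝ᵥ G *ᵥ n) : ℝ) : ℂ) := by
      have hq : n ⬝ᵥ G *ᵥ n = ∑ i, ∑ j, n i * (G i j * n j) := by
        simp only [dotProduct, Matrix.mulVec_eq_sum, Finset.mul_sum, Finset.sum_apply]
        simp [mul_comm]
      rw [hB, hq]
      simp only [Finset.sum_mul, Finset.mul_sum, Matrix.trace_sum, Matrix.smul_mul,
        Matrix.mul_smul, Matrix.trace_smul, hGg, smul_eq_mul]
      push_cast
      rw [Finset.sum_comm]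
      refine Finset.sum_congr rfl fun i _ => Finset.sum_congr rfl fun j _ => ?_
      ring
    have h3 : ∀ i, ((pauliBlock ρ i - (n i : ℂ) • B) * (pauliBlock ρ i - (n i : ℂ) • B)).trace
        = ((2 / N ^ 2 * G i i : ℝ) : ℂ) - 2 * ((n i : ℂ) * (pauliBlock ρ i * B).trace)
          + (n i : ℂ) * n i * (B * B).trace := by
      intro i
      rw [← hGg]
      simp only [sub_mul, mul_sub, Matrix.smul_mul, Matrix.mul_smul, Matrix.trace_sub,
        Matrix.trace_smul, smul_eq_mul, Matrix.trace_mul_comm B]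
      ring
    simp only [h3, Finset.sum_add_distrib, Finset.sum_sub_distrib, ← Finset.mul_sum,
      ← Finset.sum_mul, h1]
    rw [Fin.sum_univ_three (fun i => (n i : ℂ) * n i), hnc, h2]
    push_cast
    rw [← Finset.mul_sum]
    ring
  rw [DU, frob, sub_conjA_pauliVec ρ hn, trace_conjTranspose_mul_self_pauli_expansion hS, hsum,
    htr]
  rw [show (2 : ℂ) = ((2 : ℝ) : ℂ) by norm_num, ← Complex.ofReal_mul, Complex.ofReal_re,
    ← mul_assoc, Real.sqrt_mul (by positivity), ← mul_assoc]
  congr 1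
  rw [Real.sqrt_mul (by positivity), Real.sqrt_div (by positivity),
    Real.sqrt_sq (by positivity)]
  field_simp

lemma dotProduct_mulVec_le_iSup_eigenvalues {ι : Type*} [Fintype ι] [DecidableEq ι]
    {A : Matrix ι ι ℝ} (hA : A.IsHermitian) {n : ι → ℝ} (hn : n ⬝ᵥ n = 1) :
    n ⬝ᵥ A *ᵥ n ≤ ⨆ k, hA.eigenvalues k := by
  have hsp := hA.spectral_theorem
  rw [Unitary.conjStarAlgAut_apply, Matrix.star_eq_conjTranspose,
    Matrix.conjTranspose_eq_transpose_of_trivial] at hsp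
  have hEE : (hA.eigenvectorUnitary).1 * (hA.eigenvectorUnitary).1ᵀ = 1 :=
    Matrix.mem_unitaryGroup_iff.mp hA.eigenvectorUnitary.2
  set E : Matrix ι ι ℝ := hA.eigenvectorUnitary.1
  set v := Eᵀ *ᵥ n with hv
  have hvE : n ᵥ* E = v := by rw [hv, Matrix.mulVec_transpose]
  have hvv : v ⬝ᵥ v = 1 := by
    nth_rewrite 1 [← hvE]
    rw [← Matrix.dotProduct_mulVec, hv, Matrix.mulVec_mulVec, hEE, Matrix.one_mulVec]
    exact hn
  have hq : n ⬝ᵥ A *ᵥ n = ∑ k, hA.eigenvalues k * (v k * v k) := by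
    conv_lhs =>
      rw [hsp, ← Matrix.mulVec_mulVec, ← Matrix.mulVec_mulVec, Matrix.dotProduct_mulVec, hvE]
    simp only [dotProduct, Matrix.mulVec_diagonal, Function.comp_apply, RCLike.ofReal_real_eq_id,
      id_eq]
    exact Finset.sum_congr rfl fun k _ => by ring
  calc n ⬝ᵥ A *ᵥ n = ∑ k, hA.eigenvalues k * (v k * v k) := hq
    _ ≤ ∑ k, (⨆ k, hA.eigenvalues k) * (v k * v k) := by
        refine Finset.sum_le_sum fun k _ => ?_
        exact mul_le_mul_of_nonneg_right
          (le_ciSup (Set.finite_range hA.eigenvalues).bddAbove k) (mul_self_nonneg _)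
    _ = _ := by rw [← Finset.mul_sum, ← dotProduct, hvv, mul_one]

lemma exists_dotProduct_mulVec_eq_iSup_eigenvalues {ι : Type*} [Fintype ι] [DecidableEq ι]
    [Nonempty ι] {A : Matrix ι ι ℝ} (hA : A.IsHermitian) :
    ∃ n : ι → ℝ, n ⬝ᵥ n = 1 ∧ n ⬝ᵥ A *ᵥ n = ⨆ k, hA.eigenvalues k := by
  obtain ⟨k, hk⟩ := exists_eq_ciSup_of_finite (f := hA.eigenvalues)
  have h1 : (hA.eigenvectorBasis k).ofLp ⬝ᵥ (hA.eigenvectorBasis k).ofLp = 1 := by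
    have := hA.eigenvectorBasis.orthonormal.1 k
    have h2 := real_inner_self_eq_norm_sq (hA.eigenvectorBasis k)
    rw [this, EuclideanSpace.inner_eq_star_dotProduct] at h2
    simpa using h2
  refine ⟨(hA.eigenvectorBasis k).ofLp, h1, ?_⟩
  rw [hA.mulVec_eigenvectorBasis, dotProduct_smul, h1, hk, smul_eq_mul, mul_one]

/-- If the reduced state on the first factor is maximally mixed,
`Tr_B(ρ) = I₂/2`, then `D(ρ) = (√2/N)·√(Σ T_{ij}² − λ_max(T Tᵀ))`. -/
theorem D_eq_corr_bound_of_maximally_mixed {N : ℕ} (hN : 0 < N)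
    (ρ : Matrix (Fin 2 × Fin N) (Fin 2 × Fin N) ℂ) (hρ : IsState ρ)
    (hmix : traceB ρ = (1 / 2 : ℂ) • (1 : Matrix (Fin 2) (Fin 2) ℂ))
    (σB : Fin (N ^ 2 - 1) → Matrix (Fin N) (Fin N) ℂ)
    (hherm : ∀ j, (σB j).IsHermitian)
    (htrace : ∀ j, (σB j).trace = 0)
    (horth : ∀ i j, (σB i * σB j).trace = if i = j then 2 else 0) :
    Dm ρ = (Real.sqrt 2 / N) * Real.sqrt
      ((∑ i, ∑ j, corrT ρ σB i j ^ 2)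
        - ⨆ k, (real_isHermitian_mul_transpose_self (corrT ρ σB)).eigenvalues k) := by
  have hρh : ρ.IsHermitian := hρ.1.isHermitian
  refine IsLeast.csInf_eq ⟨?_, ?_⟩
  · obtain ⟨n, hn, hmax⟩ := exists_dotProduct_mulVec_eq_iSup_eigenvalues
      (real_isHermitian_mul_transpose_self (corrT ρ σB))
    exact ⟨pauliVec n, isRU_pauliVec hn, by
      rw [DU_pauliVec hN hρh hmix hherm htrace horth hn, hmax]⟩
  · rintro d ⟨U, hU, rfl⟩
    obtain ⟨n, hn, rfl⟩ := exists_pauliVec_of_isRU hU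
    rw [DU_pauliVec hN hρh hmix hherm htrace horth hn]
    gcongr
    exact dotProduct_mulVec_le_iSup_eigenvalues _ hn

end
end

section
/- Let d ≥ 2 and 0 ≤ p ≤ 1, and let ρ be the Werner state on ℂ^d ⊗ ℂ^d, i.e., ρ = (2p/(d²+d))·P_s + (2(1−p)/(d²−d))·P_a, where P_s = (I+P)/2, P_a = (I−P)/2, and P = Σ_{i,j=1}^d |i⟩⟨j| ⊗ |j⟩⟨i| is the swap operator. Then D(ρ) = 0 if and only if p = (d+1)/(2d). -/
open Matrix Kronecker BigOperators ComplexOrder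

noncomputable section

/-- The swap operator `P = Σ_{i,j} |i⟩⟨j| ⊗ |j⟩⟨i|` on `ℂ^d ⊗ ℂ^d`. -/
def swapOp (d : ℕ) : Matrix (Fin d × Fin d) (Fin d × Fin d) ℂ :=
  Matrix.of fun p q => if p.1 = q.2 ∧ p.2 = q.1 then 1 else 0

/-- The Werner state `ρ = (2p/(d²+d))·P_s + (2(1−p)/(d²−d))·P_a`, where
`P_s = (I+P)/2` and `P_a = (I−P)/2`. -/
def werner (d : ℕ) (p : ℝ) : Matrix (Fin d × Fin d) (Fin d × Fin d) ℂ :=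
  (2 * p / (d ^ 2 + d) : ℝ) • ((1 / 2 : ℝ) • ((1 : Matrix (Fin d × Fin d) (Fin d × Fin d) ℂ) + swapOp d)) +
  (2 * (1 - p) / (d ^ 2 - d) : ℝ) • ((1 / 2 : ℝ) • ((1 : Matrix (Fin d × Fin d) (Fin d × Fin d) ℂ) - swapOp d))

/-- The coefficient of the swap operator in the Werner state. -/
def wernerSwapCoeff (d : ℕ) (p : ℝ) : ℝ := p / (d ^ 2 + d) - (1 - p) / (d ^ 2 - d)

theorem wernerSwapCoeff_eq_zero_iff {d : ℕ} (hd : 2 ≤ d) (p : ℝ) :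
    wernerSwapCoeff d p = 0 ↔ p = ((d : ℝ) + 1) / (2 * d) := by
  have hd' : (2 : ℝ) ≤ d := by exact_mod_cast hd
  have h0 : (d : ℝ) ≠ 0 := by positivity
  have h1 : (d : ℝ) ^ 2 + d ≠ 0 := by positivity
  have h2 : (d : ℝ) ^ 2 - d ≠ 0 := by nlinarith
  rw [wernerSwapCoeff, sub_eq_zero, div_eq_div_iff h1 h2, eq_div_iff (by positivity)]
  constructor
  · intro h
    apply mul_left_cancel₀ h0
    linear_combination h
  · intro h
    linear_combination (d : ℝ) * h

theorem werner_eq_smul_one_add_smul_swapOp (d : ℕ) (p : ℝ) :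
    werner d p = (p / (d ^ 2 + d) + (1 - p) / (d ^ 2 - d) : ℝ) •
      (1 : Matrix (Fin d × Fin d) (Fin d × Fin d) ℂ) + wernerSwapCoeff d p • swapOp d := by
  unfold werner wernerSwapCoeff
  module

theorem conjTranspose_swapOp (d : ℕ) : (swapOp d)ᴴ = swapOp d := by
  ext ⟨i, j⟩ ⟨k, l⟩
  simp only [swapOp, conjTranspose_apply, of_apply, apply_ite star, star_one, star_zero]
  congr 1
  grind

theorem swapOp_mul_apply {d : ℕ} (A : Matrix (Fin d × Fin d) (Fin d × Fin d) ℂ)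
    (p q : Fin d × Fin d) : (swapOp d * A) p q = A p.swap q := by
  rw [mul_apply, Finset.sum_eq_single p.swap]
  · simp [swapOp]
  · intro b _ hb
    have : ¬(p.1 = b.2 ∧ p.2 = b.1) := fun h => hb (Prod.ext h.2.symm h.1.symm)
    simp [swapOp, this]
  · simp

theorem swapOp_mul_self (d : ℕ) : swapOp d * swapOp d = 1 := by
  ext ⟨i, j⟩ ⟨k, l⟩
  rw [swapOp_mul_apply]
  simp only [swapOp, of_apply, one_apply, Prod.swap, Prod.mk.injEq]
  congr 1
  grind

theorem conjA_swapOp {d : ℕ} (U : Matrix (Fin d) (Fin d) ℂ) :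
    conjA U (swapOp d) =
      (U ⊗ₖ (1 : Matrix (Fin d) (Fin d) ℂ)) * ((1 : Matrix (Fin d) (Fin d) ℂ) ⊗ₖ Uᴴ) *
        swapOp d := by
  unfold conjA
  rw [mul_assoc, mul_assoc]
  congr 1
  have h : swapOp d * (U ⊗ₖ (1 : Matrix (Fin d) (Fin d) ℂ))ᴴ * swapOp d =
      (1 : Matrix (Fin d) (Fin d) ℂ) ⊗ₖ Uᴴ := by
    rw [mul_assoc]
    ext ⟨i, j⟩ ⟨k, l⟩
    rw [swapOp_mul_apply]
    have := swapOp_mul_apply (d := d) (U ⊗ₖ (1 : Matrix (Fin d) (Fin d) ℂ)) (k, l) (j, i)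
    rw [← conjTranspose_swapOp d, ← conjTranspose_mul, conjTranspose_apply, Prod.swap, this]
    simp [kroneckerMap_apply, one_apply, eq_comm, apply_ite (starRingEnd ℂ)]
  rw [← h, mul_assoc, swapOp_mul_self, mul_one]

theorem trace_conjA_swapOp_mul_swapOp {d : ℕ} (U : Matrix (Fin d) (Fin d) ℂ) :
    (conjA U (swapOp d) * swapOp d).trace = U.trace * Uᴴ.trace := by
  rw [conjA_swapOp, mul_assoc, swapOp_mul_self, mul_one, ← mul_kronecker_mul, mul_one, one_mul,
    trace_kronecker]

theorem conjA_one {M N : ℕ} {U : Matrix (Fin M) (Fin M) ℂ} (hU : U ∈ unitaryGroup (Fin M) ℂ) :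
    conjA U (1 : Matrix (Fin M × Fin N) (Fin M × Fin N) ℂ) = 1 := by
  rw [conjA, mul_one, conjTranspose_kronecker, ← mul_kronecker_mul, ← star_eq_conjTranspose U,
    mem_unitaryGroup_iff.mp hU]
  simp

theorem conjA_mul {M N : ℕ} {U : Matrix (Fin M) (Fin M) ℂ} (hU : U ∈ unitaryGroup (Fin M) ℂ)
    (A B : Matrix (Fin M × Fin N) (Fin M × Fin N) ℂ) :
    conjA U A * conjA U B = conjA U (A * B) := by
  have h : (U ⊗ₖ (1 : Matrix (Fin N) (Fin N) ℂ))ᴴ * (U ⊗ₖ (1 : Matrix (Fin N) (Fin N) ℂ)) = 1 := by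
    rw [conjTranspose_kronecker, ← mul_kronecker_mul, ← star_eq_conjTranspose U,
      mem_unitaryGroup_iff'.mp hU]
    simp
  unfold conjA
  simp only [mul_assoc]
  rw [← mul_assoc _ᴴ (U ⊗ₖ _), h, one_mul]

theorem conjTranspose_conjA {M N : ℕ} (U : Matrix (Fin M) (Fin M) ℂ)
    (A : Matrix (Fin M × Fin N) (Fin M × Fin N) ℂ) : (conjA U A)ᴴ = conjA U Aᴴ := by
  simp [conjA, conjTranspose_mul, mul_assoc]

theorem frob_smul {n : Type*} [Fintype n] (c : ℝ) (A : Matrix n n ℂ) :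
    frob (c • A) = |c| * frob A := by
  have : ((c • A)ᴴ * (c • A)).trace.re = c ^ 2 * (Aᴴ * A).trace.re := by
    simp [conjTranspose_smul, trace_smul, smul_smul, sq]
  rw [frob, frob, this, Real.sqrt_mul (sq_nonneg c), Real.sqrt_sq_eq_abs]

theorem frob_swapOp_sub_conjA {d : ℕ} {U : Matrix (Fin d) (Fin d) ℂ}
    (hU : U ∈ unitaryGroup (Fin d) ℂ) (htr : U.trace = 0) :
    frob (swapOp d - conjA U (swapOp d)) = Real.sqrt 2 * d := by
  have h : ((swapOp d - conjA U (swapOp d))ᴴ * (swapOp d - conjA U (swapOp d))).trace =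
      2 * (d : ℂ) ^ 2 := by
    rw [conjTranspose_sub, conjTranspose_conjA, conjTranspose_swapOp, sub_mul, mul_sub, mul_sub,
      swapOp_mul_self, conjA_mul hU, swapOp_mul_self, conjA_one hU, trace_sub, trace_sub, trace_sub,
      trace_mul_comm (swapOp d), trace_conjA_swapOp_mul_swapOp, htr, trace_one]
    simp
    ring
  rw [frob, h]
  have : (2 * (d : ℂ) ^ 2).re = 2 * (d : ℝ) ^ 2 := by exact_mod_cast rfl
  rw [this, Real.sqrt_mul zero_le_two, Real.sqrt_sq d.cast_nonneg]

theorem DU_werner {d : ℕ} (p : ℝ) {U : Matrix (Fin d) (Fin d) ℂ}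
    (hU : U ∈ unitaryGroup (Fin d) ℂ) (htr : U.trace = 0) :
    DU (werner d p) U = |wernerSwapCoeff d p| * d := by
  have h : werner d p - conjA U (werner d p) =
      wernerSwapCoeff d p • (swapOp d - conjA U (swapOp d)) := by
    have h1 : ∀ a b : ℝ, ∀ A B : Matrix (Fin d × Fin d) (Fin d × Fin d) ℂ,
        conjA U (a • A + b • B) = a • conjA U A + b • conjA U B := by
      intro a b A B
      simp [conjA, mul_add, add_mul]
    rw [werner_eq_smul_one_add_smul_swapOp, h1, conjA_one hU]
    module
  rw [DU, h, frob_smul, frob_swapOp_sub_conjA hU htr]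
  field_simp

theorem rootOfUnity_eq_pow {M : ℕ} (k : ℕ) :
    Complex.exp (2 * Real.pi * Complex.I * ((k : ℂ) + 1) / (M : ℂ)) =
      Complex.exp (2 * Real.pi * Complex.I / (M : ℂ)) ^ (k + 1) := by
  rw [← Complex.exp_nat_mul]
  push_cast
  ring_nf

theorem IsRU.mem_unitaryGroup {M : ℕ} {U : Matrix (Fin M) (Fin M) ℂ} (hU : IsRU U) :
    U ∈ unitaryGroup (Fin M) ℂ := by
  obtain ⟨V, hV, rfl⟩ := hU
  refine mul_mem (mul_mem hV ?_) (Unitary.star_mem hV)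
  rw [mem_unitaryGroup_iff, star_eq_conjTranspose, diagonal_conjTranspose, diagonal_mul_diagonal,
    ← diagonal_one]
  congr 1
  ext k
  simp only [Pi.star_apply, RCLike.star_def, Complex.mul_conj, Complex.normSq_eq_norm_sq]
  have : 2 * Real.pi * Complex.I * (((k : ℕ) : ℂ) + 1) / (M : ℂ) =
      ((2 * Real.pi * ((k : ℕ) + 1) / M : ℝ) : ℂ) * Complex.I := by
    push_cast
    ring
  rw [this, Complex.norm_exp_ofReal_mul_I]
  simp

theorem IsRU.trace_eq_zero {M : ℕ} (hM : 2 ≤ M) {U : Matrix (Fin M) (Fin M) ℂ} (hU : IsRU U) :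
    U.trace = 0 := by
  obtain ⟨V, hV, rfl⟩ := hU
  rw [trace_mul_comm, ← mul_assoc, ← star_eq_conjTranspose V, mem_unitaryGroup_iff'.mp hV, one_mul,
    trace_diagonal]
  simp only [rootOfUnity_eq_pow, pow_succ]
  rw [← Finset.sum_mul, Fin.sum_univ_eq_sum_range
    (fun k => Complex.exp (2 * Real.pi * Complex.I / (M : ℂ)) ^ k),
    (Complex.isPrimitiveRoot_exp M (by lia)).geom_sum_eq_zero (by lia), zero_mul]

theorem exists_isRU (M : ℕ) : ∃ U : Matrix (Fin M) (Fin M) ℂ, IsRU U :=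
  ⟨_, 1, one_mem _, rfl⟩

theorem Dm_werner {d : ℕ} (hd : 2 ≤ d) (p : ℝ) :
    Dm (werner d p) = |wernerSwapCoeff d p| * d := by
  have h : {x : ℝ | ∃ U, IsRU U ∧ x = DU (werner d p) U} = {|wernerSwapCoeff d p| * d} := by
    ext x
    constructor
    · rintro ⟨U, hU, rfl⟩
      exact DU_werner p hU.mem_unitaryGroup (hU.trace_eq_zero hd)
    · rintro rfl
      obtain ⟨U, hU⟩ := exists_isRU d
      exact ⟨U, hU, (DU_werner p hU.mem_unitaryGroup (hU.trace_eq_zero hd)).symm⟩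
  rw [Dm, h, csInf_singleton]

/-- For the Werner state on `ℂ^d ⊗ ℂ^d` (`d ≥ 2`, `0 ≤ p ≤ 1`),
`D(ρ) = 0` if and only if `p = (d+1)/(2d)`. -/
theorem D_werner_eq_zero_iff (d : ℕ) (hd : 2 ≤ d) (p : ℝ) (hp0 : 0 ≤ p) (hp1 : p ≤ 1) :
    Dm (werner d p) = 0 ↔ p = ((d : ℝ) + 1) / (2 * d) := by
  have hd0 : (d : ℝ) ≠ 0 := by positivity
  rw [Dm_werner hd, mul_eq_zero, or_iff_left hd0, abs_eq_zero, wernerSwapCoeff_eq_zero_iff hd]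

end
end
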